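/- Let n ≥ 2 and let f ∈ ℂ[x₁,…,xₙ] be a non-constant polynomial with f(0) = 0 which is convenient and non-degenerate at 0. With the deformation setup (P, l, σ_y f, Ω) fixed, the set Ω contains the origin 0 ∈ ℂ^l and is a path-connected subset of ℂ^l with its standard Euclidean topology. -/

import Mathlib

open MvPolynomial

noncomputable section

/-- The exponent vector of a monomial, regarded as a point of `ℝⁿ`. -/
def expR {n : ℕ} (α : Fin n →₀ ℕ) : Fin n → ℝ := fun i => (α i : ℝ)

/-- The convex hull of the union, over `α ∈ s`, of the translates `α + ℝ₊ⁿ` of the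
nonnegative orthant. -/
def newtonRegion {n : ℕ} (s : Set (Fin n →₀ ℕ)) : Set (Fin n → ℝ) :=
  convexHull ℝ {x | ∃ α ∈ s, ∃ r : Fin n → ℝ, (∀ i, 0 ≤ r i) ∧ x = expR α + r}

/-- The Newton polyhedron `Γ₊(f)` of `f` at the origin. -/
def NewtonPolyhedron {n : ℕ} (f : MvPolynomial (Fin n) ℂ) : Set (Fin n → ℝ) :=
  newtonRegion {α | α ∈ f.support}

/-- The union of all bounded (nonempty, exposed) faces of `A`. -/
def boundedFacesUnion {n : ℕ} (A : Set (Fin n → ℝ)) : Set (Fin n → ℝ) :=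
  {x | ∃ F : Set (Fin n → ℝ), F.Nonempty ∧ IsExposed ℝ A F ∧
    Bornology.IsBounded F ∧ x ∈ F}

/-- The Newton boundary `Γ_f` of `f`: the union of the bounded faces of `Γ₊(f)`. -/
def NewtonBoundary {n : ℕ} (f : MvPolynomial (Fin n) ℂ) : Set (Fin n → ℝ) :=
  boundedFacesUnion (NewtonPolyhedron f)

/-- `f` is convenient: `Γ₊(f)` meets the positive part of every coordinate axis. -/
def Convenient {n : ℕ} (f : MvPolynomial (Fin n) ℂ) : Prop :=
  ∀ i : Fin n, ∃ t : ℝ, 0 < t ∧ Pi.single i t ∈ NewtonPolyhedron f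

open Classical in
/-- The part `f_F` of `f` supported on a subset `F ⊆ ℝⁿ`. -/
def faceRestrict {n : ℕ} (f : MvPolynomial (Fin n) ℂ) (F : Set (Fin n → ℝ)) :
    MvPolynomial (Fin n) ℂ :=
  ∑ α ∈ f.support.filter (fun α => expR α ∈ F), monomial α (f.coeff α)

/-- The system `g = ∂g/∂x₁ = ⋯ = ∂g/∂xₙ = 0` has a solution in `(ℂ ∖ {0})ⁿ`. -/
def hasTorusSolution {n : ℕ} (g : MvPolynomial (Fin n) ℂ) : Prop :=
  ∃ x : Fin n → ℂ, (∀ i, x i ≠ 0) ∧ eval x g = 0 ∧ ∀ i, eval x (pderiv i g) = 0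

/-- `f` is non-degenerate at `0`: for every bounded face `F` of `Γ₊(f)` the system
`f_F = ∂f_F/∂x₁ = ⋯ = ∂f_F/∂xₙ = 0` has no solution in the torus. -/
def NondegAtZero {n : ℕ} (f : MvPolynomial (Fin n) ℂ) : Prop :=
  ∀ F : Set (Fin n → ℝ), F.Nonempty → IsExposed ℝ (NewtonPolyhedron f) F →
    Bornology.IsBounded F → ¬ hasTorusSolution (faceRestrict f F)

/-- `x` is a singular point of the hypersurface `{h = 0} ⊆ ℂⁿ`. -/
def IsSingularPt {n : ℕ} (h : MvPolynomial (Fin n) ℂ) (x : Fin n → ℂ) : Prop :=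
  eval x h = 0 ∧ ∀ i, eval x (pderiv i h) = 0

/-- The deformed polynomial `σ_y f = Σ_α (a_α + y_α) x^α`. -/
def perturb {n : ℕ} (f : MvPolynomial (Fin n) ℂ) (S : Finset (Fin n →₀ ℕ))
    (y : {α // α ∈ S} → ℂ) : MvPolynomial (Fin n) ℂ :=
  f + ∑ α ∈ S.attach, monomial α.1 (y α)

/-- The parameter set `Ω ⊆ ℂ^{P ∩ ℤⁿ}`. -/
def Omega {n : ℕ} (f : MvPolynomial (Fin n) ℂ) (S : Finset (Fin n →₀ ℕ)) :
    Set ({α // α ∈ S} → ℂ) :=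
  {y | NewtonBoundary (perturb f S y) = NewtonBoundary f ∧ NondegAtZero (perturb f S y)}

/-- Over a field of characteristic zero, a derivation can be prescribed arbitrarily on a
transcendence basis. -/
lemma IsTranscendenceBasis.exists_derivation {ι F E : Type*} [Field F] [CharZero F] [Field E]
    [Algebra F E] {x : ι → E} (hx : IsTranscendenceBasis F x) (d : ι → E) :
    ∃ D : Derivation F E E, ∀ i, D (x i) = d i := by
  let : Algebra (MvPolynomial ι F) E := (aeval x).toAlgebra
  have hinj : Function.Injective (algebraMap (MvPolynomial ι F) E) := hx.1
  have : FaithfulSMul (MvPolynomial ι F) E :=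
    (faithfulSMul_iff_algebraMap_injective _ _).2 hinj
  have : IsScalarTower F (MvPolynomial ι F) E :=
    IsScalarTower.of_algebraMap_eq fun a => ((aeval x).commutes a).symm
  let _ := FractionRing.liftAlgebra (MvPolynomial ι F) E
  have := FractionRing.isScalarTower_liftAlgebra (MvPolynomial ι F) E
  have : CharZero (FractionRing (MvPolynomial ι F)) :=
    charZero_of_injective_algebraMap (algebraMap F _).injective
  have : Algebra.IsAlgebraic (MvPolynomial ι F) E := by
    refine (hx.isAlgebraic_iff (S := MvPolynomial ι F)).2 fun i => ?_
    have : x i = algebraMap (MvPolynomial ι F) E (X i) := (aeval_X x i).symm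
    rw [this]
    exact isAlgebraic_algebraMap _
  have : Algebra.IsAlgebraic (FractionRing (MvPolynomial ι F)) E :=
    Algebra.IsAlgebraic.extendScalars (R := MvPolynomial ι F)
      (IsFractionRing.injective (MvPolynomial ι F) (FractionRing (MvPolynomial ι F)))
  have : Algebra.FormallyEtale (FractionRing (MvPolynomial ι F)) E :=
    Algebra.FormallyEtale.of_isSeparable _ E
  have : Algebra.FormallyEtale (MvPolynomial ι F) (FractionRing (MvPolynomial ι F)) :=
    Algebra.FormallyEtale.of_isLocalization (nonZeroDivisors _)
  have : Algebra.FormallyEtale (MvPolynomial ι F) E :=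
    Algebra.FormallyEtale.comp _ (FractionRing (MvPolynomial ι F)) _
  let e := KaehlerDifferential.tensorKaehlerEquivOfFormallyEtale F (MvPolynomial ι F) E
  let L := (mkDerivation F d : Derivation F (MvPolynomial ι F) E).liftKaehlerDifferential
  refine ⟨((L.liftBaseChange E).comp e.symm.toLinearMap).compDer (KaehlerDifferential.D F E),
    fun i => ?_⟩
  have hX : x i = algebraMap (MvPolynomial ι F) E (X i) := (aeval_X x i).symm
  rw [hX]
  simp [e, L, KaehlerDifferential.tensorKaehlerEquivOfFormallyEtale_symm_D_algebraMap,
    mkDerivation_X]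

/-- Over a field of characteristic zero, a derivation can be prescribed arbitrarily on an
algebraically independent family. -/
lemma AlgebraicIndependent.exists_derivation {ι F E : Type*} [Field F] [CharZero F] [Field E]
    [Algebra F E] {x : ι → E} (hx : AlgebraicIndependent F x) (d : ι → E) :
    ∃ D : Derivation F E E, ∀ i, D (x i) = d i := by
  obtain ⟨t, ht, hb⟩ := exists_isTranscendenceBasis_superset hx.coe_range
  obtain ⟨D, hD⟩ := hb.exists_derivation (Function.extend x d 0 ∘ Subtype.val)
  exact ⟨D, fun i => (hD ⟨x i, ht ⟨i, rfl⟩⟩).trans (hx.injective.extend_apply d 0 i)⟩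

/-- Over a countable subfield of `ℂ` there are finite algebraically independent families of
any size. -/
lemma exists_algebraicIndependent_complex (K : Subfield ℂ) [Countable K] (ι : Type*) [Finite ι] :
    ∃ h : ι → ℂ, AlgebraicIndependent K h := by
  obtain ⟨s, hs⟩ := exists_isTranscendenceBasis K ℂ
  have : Infinite s := by
    by_contra hfin
    rw [not_infinite_iff_finite] at hfin
    have h := IsAlgClosed.cardinal_le_max_transcendence_basis _ hs
    have h1 : Cardinal.mk K ≤ Cardinal.aleph0 := Cardinal.mk_le_aleph0
    have h2 : Cardinal.mk s ≤ Cardinal.aleph0 := Cardinal.mk_le_aleph0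
    simp only [Cardinal.lift_id, Cardinal.mk_complex] at h
    exact absurd (h.trans (max_le (max_le h1 h2) le_rfl)) (not_le.2 Cardinal.aleph0_lt_continuum)
  let φ : ι ↪ s := (Finite.equivFin ι).toEmbedding.trans
    (Fin.valEmbedding.trans (Infinite.natEmbedding s))
  exact ⟨_, hs.1.comp φ φ.injective⟩

/-- All but countably many complex numbers are transcendental over a countable subfield
extended by a finite family. -/
lemma countable_setOf_not_algebraicIndependent_option (K : Subfield ℂ) [Countable K] {ι : Type*}
    [Finite ι] {h : ι → ℂ} (hh : AlgebraicIndependent K h) :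
    {t : ℂ | ¬ AlgebraicIndependent K fun o : Option ι => o.elim t h}.Countable := by
  have : Countable (Algebra.adjoin K (Set.range h)) := by
    have : Countable (MvPolynomial ι K) := by
      rw [← Cardinal.mk_le_aleph0_iff]
      refine cardinalMk_le_max_lift.trans ?_
      simp
    rw [Algebra.adjoin_range_eq_range_aeval]
    exact (AlgHom.rangeRestrict_surjective (aeval h)).countable
  simp only [hh.option_iff_transcendental, Transcendental, not_not]
  exact Algebraic.countable _ _

lemma Derivation.apply_eval_monomial_one {R σ : Type*} [CommRing R] [Algebra R ℂ] [Fintype σ]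
    (D : Derivation R ℂ ℂ) (x : σ → ℂ) (α : σ →₀ ℕ) :
    D (eval x (monomial α 1)) = ∑ i, D (x i) * eval x (pderiv i (monomial α 1)) := by
  classical
  induction α using Finsupp.induction_linear with
  | zero => simp
  | add a b ha hb =>
    have : (monomial (a + b) (1 : ℂ)) = monomial a 1 * monomial b 1 := by
      rw [monomial_mul, one_mul]
    simp only [this, map_mul, Derivation.leibniz, ha, hb, smul_eq_mul, map_add, mul_add,
      Finset.sum_add_distrib, Finset.mul_sum]
    congr 1 <;> exact Finset.sum_congr rfl fun i _ => by ring
  | single j k =>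
    rw [← X_pow_eq_monomial, Finset.sum_eq_single j]
    · simp [Derivation.leibniz_pow]
      ring
    · intro i _ hij
      simp [Derivation.leibniz_pow, pderiv_X_of_ne hij.symm]
    · simp

/-- The chain rule for a derivation applied to a value of a polynomial. -/
lemma Derivation.apply_eval {R σ : Type*} [CommRing R] [Algebra R ℂ] [Fintype σ]
    (D : Derivation R ℂ ℂ) (x : σ → ℂ) (p : MvPolynomial σ ℂ) :
    D (eval x p) = ∑ α ∈ p.support, D (p.coeff α) * eval x (monomial α 1) +
      ∑ i, D (x i) * eval x (pderiv i p) := by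
  have hmon : ∀ α c, monomial α c = C c * (monomial α 1 : MvPolynomial σ ℂ) := fun α c => by
    rw [C_mul_monomial, mul_one]
  conv_lhs => rw [p.as_sum]
  conv_rhs => enter [2, 2, i]; rw [p.as_sum]
  simp only [map_sum, Finset.mul_sum]
  rw [Finset.sum_comm, ← Finset.sum_add_distrib]
  refine Finset.sum_congr rfl fun α _ => ?_
  rw [hmon α (p.coeff α)]
  simp only [map_mul, eval_C, Derivation.leibniz, D.apply_eval_monomial_one, smul_eq_mul,
    pderiv_C, mul_zero, add_zero, Finset.mul_sum]
  rw [add_comm, mul_comm (eval x _)]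
  congr 1
  exact Finset.sum_congr rfl fun i _ => by ring

/-- An algebraic form of Bertini's theorem: a polynomial one of whose coefficients is moved by a
derivation killing all the others has no singular zero in the torus. -/
lemma not_hasTorusSolution_of_derivation {R : Type*} [CommRing R] [Algebra R ℂ] {n : ℕ}
    {g : MvPolynomial (Fin n) ℂ} (D : Derivation R ℂ ℂ) {v : Fin n →₀ ℕ}
    (hv : D (g.coeff v) ≠ 0) (h0 : ∀ α, α ≠ v → D (g.coeff α) = 0) : ¬ hasTorusSolution g := by
  rintro ⟨x, hx, hg, hdg⟩
  have key := D.apply_eval x g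
  rw [hg, map_zero, Finset.sum_eq_single v] at key
  · simp only [hdg, mul_zero, Finset.sum_const_zero, add_zero] at key
    refine mul_ne_zero hv ?_ key.symm
    simp [eval_monomial, Finsupp.prod, Finset.prod_ne_zero_iff, hx]
  · intro α _ hα
    simp [h0 α hα]
  · intro hmem
    simp [notMem_support_iff.1 hmem]

lemma expR_nonneg {n : ℕ} (α : Fin n →₀ ℕ) : 0 ≤ expR α := fun i => Nat.cast_nonneg (α i)

lemma expR_mem_newtonRegion {n : ℕ} {s : Set (Fin n →₀ ℕ)} {α : Fin n →₀ ℕ} (hα : α ∈ s) :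
    expR α ∈ newtonRegion s :=
  subset_convexHull ℝ _ ⟨α, hα, 0, fun _ => le_rfl, (add_zero _).symm⟩

lemma add_mem_newtonRegion {n : ℕ} {s : Set (Fin n →₀ ℕ)} {x r : Fin n → ℝ}
    (hx : x ∈ newtonRegion s) (hr : 0 ≤ r) : x + r ∈ newtonRegion s := by
  suffices h : newtonRegion s ⊆ (fun z => z + r) ⁻¹' newtonRegion s from h hx
  refine convexHull_min ?_ ((convex_convexHull ℝ _).translate_preimage_left r)
  rintro _ ⟨α, hα, q, hq, rfl⟩
  exact subset_convexHull ℝ _ ⟨α, hα, q + r, fun i => add_nonneg (hq i) (hr i), add_assoc _ _ _⟩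

lemma newtonRegion_subset_iff {n : ℕ} {s t : Set (Fin n →₀ ℕ)} :
    newtonRegion s ⊆ newtonRegion t ↔ ∀ α ∈ s, expR α ∈ newtonRegion t := by
  refine ⟨fun h α hα => h (expR_mem_newtonRegion hα), fun h => ?_⟩
  refine convexHull_min ?_ (convex_convexHull ℝ _)
  rintro _ ⟨α, hα, r, hr, rfl⟩
  exact add_mem_newtonRegion (h α hα) hr

lemma le_of_mem_newtonRegion {n : ℕ} {s : Set (Fin n →₀ ℕ)} {l : StrongDual ℝ (Fin n → ℝ)}
    (hl : ∀ r, 0 ≤ r → 0 ≤ l r) {c : ℝ} (hc : ∀ α ∈ s, c ≤ l (expR α)) {x : Fin n → ℝ}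
    (hx : x ∈ newtonRegion s) : c ≤ l x := by
  suffices h : newtonRegion s ⊆ {z | c ≤ l z} from h hx
  refine convexHull_min ?_ (convex_halfSpace_ge l.toLinearMap.isLinear c)
  rintro _ ⟨α, hα, r, hr, rfl⟩
  simpa using add_le_add (hc α hα) (hl r hr)

lemma nonneg_of_mem_newtonRegion {n : ℕ} {s : Set (Fin n →₀ ℕ)} {x : Fin n → ℝ}
    (hx : x ∈ newtonRegion s) : 0 ≤ x := fun i =>
  le_of_mem_newtonRegion (l := ContinuousLinearMap.proj i) (fun _ hr => hr i)
    (fun α _ => expR_nonneg α i) hx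

/-- The minimum of a strictly positive weight on the exponents lies on a bounded face. -/
lemma expR_mem_boundedFacesUnion {n : ℕ} {s : Set (Fin n →₀ ℕ)} {l : StrongDual ℝ (Fin n → ℝ)}
    {ε : ℝ} (hε : 0 < ε) (hl : ∀ r, 0 ≤ r → ∀ i, ε * r i ≤ l r) {α : Fin n →₀ ℕ} (hα : α ∈ s)
    (hmin : ∀ β ∈ s, l (expR α) ≤ l (expR β)) :
    expR α ∈ boundedFacesUnion (newtonRegion s) := by
  have hl0 : ∀ r, 0 ≤ r → 0 ≤ l r := fun r hr => by
    rcases isEmpty_or_nonempty (Fin n) with h | ⟨⟨i⟩⟩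
    · simp [Subsingleton.elim r 0]
    · exact (mul_nonneg hε.le (hr i)).trans (hl r hr i)
  have hmem := expR_mem_newtonRegion hα
  have hface : expR α ∈ {x ∈ newtonRegion s | ∀ y ∈ newtonRegion s, (-l) y ≤ (-l) x} :=
    ⟨hmem, fun y hy => neg_le_neg (le_of_mem_newtonRegion hl0 hmin hy)⟩
  refine ⟨_, ⟨_, hface⟩, fun _ => ⟨-l, rfl⟩, ?_, hface⟩
  refine (Metric.isBounded_Icc (0 : Fin n → ℝ) fun _ => l (expR α) / ε).subset ?_
  rintro x ⟨hx, hx'⟩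
  have hx0 := nonneg_of_mem_newtonRegion hx
  refine ⟨hx0, fun i => ?_⟩
  rw [le_div_iff₀ hε, mul_comm]
  exact (hl x hx0 i).trans (neg_le_neg_iff.1 (hx' _ hmem))

/-- A nonempty exposed face of a Newton region contains one of the given exponents. -/
lemma exists_expR_mem_of_isExposed {n : ℕ} {s : Set (Fin n →₀ ℕ)} {F : Set (Fin n → ℝ)}
    (hF : F.Nonempty) (hexp : IsExposed ℝ (newtonRegion s) F) : ∃ α ∈ s, expR α ∈ F := by
  obtain ⟨l, rfl⟩ := hexp hF
  obtain ⟨x, hx, hmax⟩ := hF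
  by_contra! hcon
  have hr : ∀ r, 0 ≤ r → l r ≤ 0 := fun r hr => by
    simpa using hmax _ (add_mem_newtonRegion hx hr)
  have hlt : ∀ α ∈ s, l (expR α) < l x := fun α hα => by
    by_contra! hle
    exact hcon α hα ⟨expR_mem_newtonRegion hα, fun y hy => (hmax y hy).trans hle⟩
  suffices h : newtonRegion s ⊆ {z | l z < l x} from lt_irrefl (l x) (h hx)
  refine convexHull_min ?_ (convex_halfSpace_lt l.toLinearMap.isLinear _)
  rintro _ ⟨α, hα, r, h, rfl⟩
  simpa using add_lt_add_of_lt_of_le (hlt α hα) (hr r h)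

/-- A point outside the Newton region of a finite set is separated from it by a weight that is
bounded below by a multiple of each coordinate on the orthant. -/
lemma exists_separating_weight {n : ℕ} (s : Finset (Fin n →₀ ℕ)) {p : Fin n → ℝ}
    (hp : p ∉ newtonRegion {α | α ∈ s}) :
    ∃ (l : StrongDual ℝ (Fin n → ℝ)) (ε : ℝ), 0 < ε ∧ (∀ r, 0 ≤ r → ∀ i, ε * r i ≤ l r) ∧
      ∀ α ∈ s, l p < l (expR α) := by
  have hdisj : Disjoint (convexHull ℝ (expR '' (s : Set (Fin n →₀ ℕ)))) (Set.Iic p) := by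
    rw [Set.disjoint_left]
    intro c hc hcp
    refine hp ?_
    have hsub : convexHull ℝ (expR '' (s : Set (Fin n →₀ ℕ))) ⊆ newtonRegion {α | α ∈ s} :=
      convexHull_min (Set.image_subset_iff.2 fun α hα => expR_mem_newtonRegion hα)
        (convex_convexHull ℝ _)
    simpa using add_mem_newtonRegion (hsub hc) (sub_nonneg.2 hcp)
  obtain ⟨m, u, v, hu, huv, hv⟩ := geometric_hahn_banach_compact_closed (convex_convexHull ℝ _)
    ((s.finite_toSet.image _).isCompact_convexHull ℝ) (convex_Iic p) isClosed_Iic hdisj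
  have hm : ∀ r, 0 ≤ r → m r ≤ 0 := fun r hr => by
    by_contra! hpos
    obtain ⟨k, hk⟩ := exists_nat_gt ((m p - v) / m r)
    have h := hv (p - (k : ℝ) • r) (sub_le_self p (smul_nonneg k.cast_nonneg hr))
    rw [div_lt_iff₀ hpos] at hk
    simp only [map_sub, map_smul, smul_eq_mul] at h
    linarith
  let q : StrongDual ℝ (Fin n → ℝ) := ∑ i, ContinuousLinearMap.proj i
  have hq : ∀ r, q r = ∑ i, r i := fun r => by simp [q]
  have hp' : v < m p := hv p Set.self_mem_Iic
  obtain ⟨ε, hε, hεp⟩ : ∃ ε : ℝ, 0 < ε ∧ ε * q p < m p - u := by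
    have hpos : 0 < m p - u := by linarith
    refine ⟨(m p - u) / (2 * (|q p| + 1)), by positivity, ?_⟩
    rw [div_mul_eq_mul_div, div_lt_iff₀ (by positivity)]
    have := le_abs_self (q p)
    have := abs_nonneg (q p)
    nlinarith
  refine ⟨ε • q - m, ε, hε, fun r hr i => ?_, fun α hα => ?_⟩
  · have h1 : r i ≤ q r := by
      rw [hq]
      exact Finset.single_le_sum (f := r) (fun j _ => hr j) (Finset.mem_univ i)
    have := mul_le_mul_of_nonneg_left h1 hε.le
    have := hm r hr
    simp only [sub_apply, smul_apply, smul_eq_mul]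
    linarith
  · have h1 := hu _ (subset_convexHull ℝ _ ⟨α, hα, rfl⟩)
    have h2 : 0 ≤ q (expR α) := by
      rw [hq]
      exact Finset.sum_nonneg fun j _ => expR_nonneg α j
    have := mul_nonneg hε.le h2
    simp only [sub_apply, smul_apply, smul_eq_mul]
    linarith

/-- The Newton region of a finite set is generated by any finite set whose Newton region contains
the bounded faces. -/
lemma newtonRegion_subset_of_boundedFacesUnion_subset {n : ℕ} (s t : Finset (Fin n →₀ ℕ))
    (h : boundedFacesUnion (newtonRegion {α | α ∈ s}) ⊆ newtonRegion {α | α ∈ t}) :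
    newtonRegion {α | α ∈ s} ⊆ newtonRegion {α | α ∈ t} := by
  rw [newtonRegion_subset_iff]
  intro α hα
  by_contra hcon
  obtain ⟨l, ε, hε, hl, hsep⟩ := exists_separating_weight t hcon
  obtain ⟨β, hβ, hmin⟩ := s.exists_min_image (fun β => l (expR β)) ⟨α, hα⟩
  have hmem := h (expR_mem_boundedFacesUnion (s := {α | α ∈ s}) hε hl hβ hmin)
  obtain ⟨γ, hγ, hle⟩ : ∃ γ ∈ t, l (expR γ) ≤ l (expR β) := by
    by_contra! hlt
    suffices hs : newtonRegion {α | α ∈ t} ⊆ {z | l (expR β) < l z} from lt_irrefl (l (expR β)) (hs hmem)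
    refine convexHull_min ?_ (convex_halfSpace_gt l.toLinearMap.isLinear _)
    rintro _ ⟨γ, hγ, r, hr, rfl⟩
    have hr0 : 0 ≤ l r := by
      rcases isEmpty_or_nonempty (Fin n) with h | ⟨⟨i⟩⟩
      · simp [Subsingleton.elim r 0]
      · exact (mul_nonneg hε.le (hr i)).trans (hl r hr i)
    simpa using add_lt_add_of_lt_of_le (hlt γ hγ) hr0
  exact (hsep γ hγ).not_ge (hle.trans (hmin α hα))

open Classical in
lemma coeff_faceRestrict {n : ℕ} (f : MvPolynomial (Fin n) ℂ) (F : Set (Fin n → ℝ))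
    (α : Fin n →₀ ℕ) : (faceRestrict f F).coeff α = if expR α ∈ F then f.coeff α else 0 := by
  simp only [faceRestrict, coeff_sum, coeff_monomial, Finset.sum_ite_eq', Finset.mem_filter,
    mem_support_iff]
  grind

open Classical in
lemma coeff_perturb {n : ℕ} (f : MvPolynomial (Fin n) ℂ) (S : Finset (Fin n →₀ ℕ))
    (y : {α // α ∈ S} → ℂ) (α : Fin n →₀ ℕ) :
    (perturb f S y).coeff α = f.coeff α + if h : α ∈ S then y ⟨α, h⟩ else 0 := by
  simp only [perturb, coeff_add, coeff_sum, coeff_monomial]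
  congr 1
  split_ifs with h
  · rw [Finset.sum_eq_single ⟨α, h⟩] <;> grind
  · exact Finset.sum_eq_zero fun β _ => if_neg fun hβ : β.1 = α => h (hβ ▸ β.2)

lemma perturb_zero {n : ℕ} (f : MvPolynomial (Fin n) ℂ) (S : Finset (Fin n →₀ ℕ)) :
    perturb f S 0 = f := by
  simp [perturb]

/-- A deformation each of whose free coefficients is moved by a derivation killing all the other
coefficients lies in `Ω`. -/
lemma mem_Omega_of_derivation {R : Type*} [CommRing R] [Algebra R ℂ] {n : ℕ}
    {f : MvPolynomial (Fin n) ℂ} {S : Finset (Fin n →₀ ℕ)}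
    (hS : newtonRegion {α | α ∈ S} = NewtonPolyhedron f) {y : {α // α ∈ S} → ℂ}
    (hD : ∀ v ∈ S, ∃ D : Derivation R ℂ ℂ, D ((perturb f S y).coeff v) ≠ 0 ∧
      ∀ α, α ≠ v → D ((perturb f S y).coeff α) = 0) : y ∈ Omega f S := by
  have hpoly : NewtonPolyhedron (perturb f S y) = newtonRegion {α | α ∈ S} := by
    refine (newtonRegion_subset_iff.2 fun α hα => ?_).antisymm
      (newtonRegion_subset_iff.2 fun α hα => expR_mem_newtonRegion ?_)
    · by_cases hαS : α ∈ S
      · exact expR_mem_newtonRegion hαS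
      · rw [hS]
        refine expR_mem_newtonRegion ?_
        simpa [coeff_perturb, hαS, mem_support_iff] using hα
    · obtain ⟨D, hD, -⟩ := hD α hα
      exact mem_support_iff.2 fun h => hD (by rw [h, map_zero])
  refine ⟨by rw [NewtonBoundary, NewtonBoundary, hpoly, hS], fun F hF hexp _ => ?_⟩
  rw [hpoly] at hexp
  obtain ⟨v, hv, hvF⟩ := exists_expR_mem_of_isExposed hF hexp
  obtain ⟨D, hDv, hD0⟩ := hD v hv
  refine not_hasTorusSolution_of_derivation D (v := v) ?_ fun α hα => ?_
  · rwa [coeff_faceRestrict, if_pos hvF]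
  · rw [coeff_faceRestrict]
    split_ifs
    exacts [hD0 α hα, map_zero D]

/-- A point of `Ω` is joined within `Ω` to any point whose coordinates are algebraically
independent over a countable field containing all the coefficients involved. -/
lemma joinedIn_Omega {n : ℕ} {f : MvPolynomial (Fin n) ℂ} {S : Finset (Fin n →₀ ℕ)}
    (hS : newtonRegion {α | α ∈ S} = NewtonPolyhedron f) (K : Subfield ℂ) [Countable K]
    (hf : ∀ α, f.coeff α ∈ K) {y h : {α // α ∈ S} → ℂ} (hyK : ∀ α, y α ∈ K)
    (hy : y ∈ Omega f S) (hh : AlgebraicIndependent K h) : JoinedIn (Omega f S) y h := by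
  have hKD : ∀ (D : Derivation K ℂ ℂ) {a : ℂ}, a ∈ K → D a = 0 := fun D a ha =>
    D.map_algebraMap ⟨a, ha⟩
  let z : ℂ → {α // α ∈ S} → ℂ := fun t => (1 - t) • y + t • h
  have hz : Continuous z := by fun_prop
  have hmem : ∀ t : ℂ, t ≠ 0 → (∀ v, ∃ D : Derivation K ℂ ℂ, D t = 0 ∧ D (h v) = 1 ∧
      ∀ α, α ≠ v → D (h α) = 0) → z t ∈ Omega f S := by
    intro t ht hD
    refine mem_Omega_of_derivation (R := K) hS fun v hv => ?_
    obtain ⟨D, hDt, hDv, hD0⟩ := hD ⟨v, hv⟩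
    have hcoeff : ∀ α, D ((perturb f S (z t)).coeff α) =
        if hα : α ∈ S then t * D (h ⟨α, hα⟩) else 0 := fun α => by
      rw [coeff_perturb]
      split_ifs with hα
      · simp [z, hKD D (hf α), hKD D (hyK ⟨α, hα⟩), hDt]
      · simp [hKD D (hf α)]
    refine ⟨D, by simpa [hcoeff, hv, hDv] using ht, fun α hα => ?_⟩
    rw [hcoeff]
    split_ifs with hαS
    · rw [hD0 ⟨α, hαS⟩ (by simpa using hα), mul_zero]
    · rfl
  classical
  have h1 : z 1 ∈ Omega f S := hmem 1 one_ne_zero fun v => by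
    obtain ⟨D, hD⟩ := hh.exists_derivation (Pi.single v 1)
    exact ⟨D, D.map_one_eq_zero, by simp [hD], fun α hα => by simp [hD, hα]⟩
  let B := {t : ℂ | ¬ AlgebraicIndependent K fun o : Option {α // α ∈ S} => o.elim t h}
  have hB : (B \ {0, 1}).Countable :=
    (countable_setOf_not_algebraicIndependent_option K hh).mono Set.sdiff_subset
  have hpath : IsPathConnected (B \ {0, 1})ᶜ :=
    hB.isPathConnected_compl_of_one_lt_rank (by simp [Complex.rank_real_complex])
  have hsub : z '' (B \ {0, 1})ᶜ ⊆ Omega f S := by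
    rintro _ ⟨t, ht, rfl⟩
    by_cases ht0 : t = 0
    · simpa [z, ht0] using hy
    by_cases ht1 : t = 1
    · exact ht1 ▸ h1
    have hind : AlgebraicIndependent K fun o : Option {α // α ∈ S} => o.elim t h := by
      by_contra hcon
      exact ht ⟨hcon, by simp [ht0, ht1]⟩
    refine hmem t ht0 fun v => ?_
    obtain ⟨D, hD⟩ := hind.exists_derivation (Pi.single (some v) 1)
    refine ⟨D, by simpa using hD none, by simpa using hD (some v), fun α hα => ?_⟩
    simpa [hα] using hD (some α)
  have hjoin := ((hpath.image hz).joinedIn (z 0) ⟨0, by simp, rfl⟩ (z 1) ⟨1, by simp, rfl⟩).mono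
    hsub
  simpa [z] using hjoin

/-- `Ω` contains the origin of `ℂ^l = ℂ^{P ∩ ℤⁿ}` and is path-connected in the
standard Euclidean (product) topology. -/
theorem stmt5 (n : ℕ) (hn : 2 ≤ n) (f : MvPolynomial (Fin n) ℂ)
    (hfnc : ¬ ∃ c : ℂ, f = C c) (hf0 : eval (0 : Fin n → ℂ) f = 0)
    (hconv : Convenient f) (hnd : NondegAtZero f)
    (P : Set (Fin n → ℝ)) (hPpoly : ∃ T : Finset (Fin n → ℝ), P = convexHull ℝ ↑T)
    (hPsub : P ⊆ NewtonPolyhedron f)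
    (S : Finset (Fin n →₀ ℕ)) (hS : ∀ α : Fin n →₀ ℕ, α ∈ S ↔ expR α ∈ P)
    (hPface : boundedFacesUnion (newtonRegion {α | α ∈ S}) = NewtonBoundary f) :
    (0 : {α // α ∈ S} → ℂ) ∈ Omega f S ∧ IsPathConnected (Omega f S) := by
  have hregion : newtonRegion {α | α ∈ S} = NewtonPolyhedron f := by
    refine (newtonRegion_subset_iff.2 fun α hα => hPsub ((hS α).1 hα)).antisymm ?_
    refine newtonRegion_subset_of_boundedFacesUnion_subset f.support S ?_
    change NewtonBoundary f ⊆ _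
    rw [← hPface]
    rintro x ⟨F, -, hF, -, hx⟩
    exact hF.subset hx
  have h0 : (0 : {α // α ∈ S} → ℂ) ∈ Omega f S := by
    simpa [Omega, perturb_zero] using hnd
  refine ⟨h0, isPathConnected_iff.2 ⟨⟨0, h0⟩, fun y hy y' hy' => ?_⟩⟩
  let A : Set ℂ := (f.coeff '' f.support) ∪ (Set.range y ∪ Set.range y')
  have hA : A.Countable := (f.support.countable_toSet.image _).union
    ((Set.countable_range y).union (Set.countable_range y'))
  let K := Subfield.closure A
  have : Countable K := by
    have := hA.to_subtype
    rw [← Cardinal.mk_le_aleph0_iff]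
    exact (Subfield.cardinalMk_closure_le_max A).trans (max_le Cardinal.mk_le_aleph0 le_rfl)
  have hf : ∀ α, f.coeff α ∈ K := fun α => by
    by_cases hα : α ∈ f.support
    · exact Subfield.subset_closure (Or.inl ⟨α, hα, rfl⟩)
    · rw [notMem_support_iff.1 hα]
      exact K.zero_mem
  obtain ⟨h, hh⟩ := exists_algebraicIndependent_complex K {α // α ∈ S}
  exact (joinedIn_Omega hregion K hf
      (fun α => Subfield.subset_closure (Or.inr (Or.inl ⟨α, rfl⟩))) hy hh).trans
    (joinedIn_Omega hregion K hf
      (fun α => Subfield.subset_closure (Or.inr (Or.inr ⟨α, rfl⟩))) hy' hh).symm
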